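/- Let A = ℂ^a and B = ℂ^b, and let φ0, φ1 be unit vectors in A ⊗ B whose reduced density matrices Tr_B |φ0⟩⟨φ0| and Tr_B |φ1⟩⟨φ1| are orthogonal (their matrix product is 0). Then for all density matrices ρ0, ρ1 on A ⊗ B with Tr_B ρ0 = Tr_B ρ1, it holds that (1/2)[(1/2 + (1/2)⟨φ0| ρ0 |φ0⟩) + (1/2 + (1/2)⟨φ1| ρ1 |φ1⟩)] ≤ 3/4. (Base case k = 1 of the swap-test parallel repetition theorem: the average probability of passing the swap test against φ0 with ρ0 and against φ1 with ρ1 is at most 3/4 whenever ρ0 and ρ1 have the same reduced state on A.) -/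

import Mathlib

open Matrix ComplexOrder

/-- Partial trace over the second factor `B = ℂ^b` of a matrix on `ℂ^a ⊗ ℂ^b`. -/
noncomputable def ptraceB {a b : ℕ} (M : Matrix (Fin a × Fin b) (Fin a × Fin b) ℂ) :
    Matrix (Fin a) (Fin a) ℂ :=
  Matrix.of fun i j => ∑ l : Fin b, M (i, l) (j, l)

/-- Two matrices with mutually orthogonal columns are separated by an orthogonal projection. -/
lemma exists_isStarProjection_mul_eq {m n p : Type*} [Fintype m] [DecidableEq m]
    (F : Matrix m n ℂ) (G : Matrix m p ℂ) (h : Fᴴ * G = 0) :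
    ∃ P : Matrix m m ℂ, IsStarProjection P ∧ P * F = F ∧ P * G = 0 := by
  let K : Submodule ℂ (EuclideanSpace ℂ m) :=
    Submodule.span ℂ (Set.range fun j => WithLp.toLp 2 (F.col j))
  let e := Matrix.toEuclideanCLM (n := m) (𝕜 := ℂ)
  have key (v : m → ℂ) : (e.symm K.starProjection) *ᵥ v =
      WithLp.ofLp (K.starProjection (WithLp.toLp 2 v)) := by
    rw [← Matrix.ofLp_toEuclideanCLM (𝕜 := ℂ) (e.symm K.starProjection) (WithLp.toLp 2 v)]
    exact congrArg (fun T => WithLp.ofLp (T (WithLp.toLp 2 v))) (e.apply_symm_apply _)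
  refine ⟨e.symm K.starProjection, ⟨?_, ?_⟩, ?_, ?_⟩
  · exact (map_mul e.symm _ _).symm.trans
      (congrArg e.symm isStarProjection_starProjection.isIdempotentElem.eq)
  · exact (map_star e.symm _).symm.trans
      (congrArg e.symm isStarProjection_starProjection.isSelfAdjoint.star_eq)
  · ext i j
    rw [← Matrix.col_apply F j i]
    have hj : WithLp.toLp 2 (F.col j) ∈ K := Submodule.subset_span ⟨j, rfl⟩
    have := congrFun (key (F.col j)) i
    rw [Submodule.starProjection_eq_self_iff.mpr hj] at this
    exact this
  · ext i j
    have hj : WithLp.toLp 2 (G.col j) ∈ Kᗮ := by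
      rw [Submodule.mem_orthogonal]
      intro u hu
      induction hu using Submodule.span_induction with
      | mem x hx =>
        obtain ⟨k, rfl⟩ := hx
        have := congrFun (congrFun h k) j
        rw [EuclideanSpace.inner_eq_star_dotProduct, dotProduct_comm]
        exact this
      | zero => simp
      | add x y _ _ hx hy => rw [inner_add_left, hx, hy, add_zero]
      | smul c x _ hx => rw [inner_smul_left, hx, mul_zero]
    have := congrFun (key (G.col j)) i
    rw [Submodule.starProjection_apply,
      Submodule.orthogonalProjectionOnto_eq_zero_iff.mpr hj] at this
    exact this

/-- The expectation of a positive semidefinite `ρ` in a unit vector fixed by an orthogonal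
projection `Q` is at most the trace of `ρ * Q`. -/
lemma Matrix.PosSemidef.dotProduct_mulVec_le_trace_mul {n : Type*} [Fintype n]
    {ρ Q : Matrix n n ℂ} (hρ : ρ.PosSemidef) (hQ : IsStarProjection Q) {φ : n → ℂ}
    (hφ : star φ ⬝ᵥ φ = 1) (hQφ : Q *ᵥ φ = φ) :
    star φ ⬝ᵥ (ρ *ᵥ φ) ≤ (ρ * Q).trace := by
  have hQH : Qᴴ = Q := hQ.isSelfAdjoint
  have hQQ : Q * Q = Q := hQ.isIdempotentElem
  have hφQ : star φ ᵥ* Q = star φ := by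
    rw [← hQH, ← star_mulVec, hQφ]
  set R := Q - vecMulVec φ (star φ) with hR
  have hRH : Rᴴ = R := by
    rw [hR, conjTranspose_sub, hQH, conjTranspose_vecMulVec, star_star]
  have hRR : R * R = R := by
    simp [hR, sub_mul, mul_sub, mul_vecMulVec, vecMulVec_mul, hQφ, hφQ, hQQ,
      vecMulVec_mulVec, hφ]
  have h := (hρ.mul_mul_conjTranspose_same R).trace_nonneg
  rw [hRH, trace_mul_comm, ← mul_assoc, hRR, trace_mul_comm, hR, mul_sub, trace_sub,
    mul_vecMulVec, trace_vecMulVec, dotProduct_comm, sub_nonneg] at h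
  exact h

lemma ptraceB_vecMulVec_star {a b : ℕ} (φ : Fin a × Fin b → ℂ) :
    ptraceB (vecMulVec φ (star φ)) =
      (Matrix.of (Function.curry φ)) * (Matrix.of (Function.curry φ))ᴴ := by
  ext i j
  simp [ptraceB, mul_apply, vecMulVec_apply]

lemma trace_ptraceB {a b : ℕ} (M : Matrix (Fin a × Fin b) (Fin a × Fin b) ℂ) :
    (ptraceB M).trace = M.trace := by
  simp [ptraceB, trace, Fintype.sum_prod_type]

open scoped Kronecker

lemma trace_mul_kronecker_one {a b : ℕ} (M : Matrix (Fin a × Fin b) (Fin a × Fin b) ℂ)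
    (P : Matrix (Fin a) (Fin a) ℂ) :
    (M * (P ⊗ₖ (1 : Matrix (Fin b) (Fin b) ℂ))).trace = (ptraceB M * P).trace := by
  simp only [trace, diag_apply, mul_apply, ptraceB, of_apply, kroneckerMap_apply, one_apply,
    Fintype.sum_prod_type, mul_ite, mul_one, mul_zero, Finset.sum_ite_eq', Finset.mem_univ,
    if_true, Finset.sum_mul]
  exact Finset.sum_congr rfl fun i _ => Finset.sum_comm

lemma kronecker_one_mulVec {a b : ℕ} (P : Matrix (Fin a) (Fin a) ℂ) (φ : Fin a × Fin b → ℂ) :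
    (P ⊗ₖ (1 : Matrix (Fin b) (Fin b) ℂ)) *ᵥ φ =
      Function.uncurry (P * Matrix.of (Function.curry φ)) := by
  ext ⟨i, l⟩
  simp [mulVec, dotProduct, one_apply, Fintype.sum_prod_type, Function.uncurry,
    mul_apply (M := P)]

lemma isStarProjection_kronecker_one {a b : ℕ} {P : Matrix (Fin a) (Fin a) ℂ}
    (hP : IsStarProjection P) :
    IsStarProjection (P ⊗ₖ (1 : Matrix (Fin b) (Fin b) ℂ)) where
  isIdempotentElem := by
    rw [IsIdempotentElem, ← mul_kronecker_mul, hP.isIdempotentElem.eq, one_mul]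
  isSelfAdjoint := by
    rw [IsSelfAdjoint, star_eq_conjTranspose, conjTranspose_kronecker, conjTranspose_one,
      ← star_eq_conjTranspose, hP.isSelfAdjoint.star_eq]

lemma dotProduct_mulVec_le_trace_ptraceB_mul {a b : ℕ}
    {ρ : Matrix (Fin a × Fin b) (Fin a × Fin b) ℂ} (hρ : ρ.PosSemidef)
    {P : Matrix (Fin a) (Fin a) ℂ} (hP : IsStarProjection P) {φ : Fin a × Fin b → ℂ}
    (hφ : star φ ⬝ᵥ φ = 1)
    (hPφ : P * Matrix.of (Function.curry φ) = Matrix.of (Function.curry φ)) :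
    star φ ⬝ᵥ (ρ *ᵥ φ) ≤ (ptraceB ρ * P).trace := by
  rw [← trace_mul_kronecker_one]
  refine hρ.dotProduct_mulVec_le_trace_mul (isStarProjection_kronecker_one hP) hφ ?_
  rw [kronecker_one_mulVec, hPφ]
  rfl

/-- Base case `k = 1` of the swap-test parallel repetition theorem: if the
reduced states of `φ0` and `φ1` on `A` are orthogonal, any two states with the
same reduced state on `A` pass the swap tests against `φ0` resp. `φ1` with
average probability at most `3/4`. -/
theorem swap_test_base_case {a b : ℕ}
    (φ0 φ1 : Fin a × Fin b → ℂ)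
    (hunit0 : star φ0 ⬝ᵥ φ0 = 1) (hunit1 : star φ1 ⬝ᵥ φ1 = 1)
    (horth : ptraceB (vecMulVec φ0 (star φ0)) * ptraceB (vecMulVec φ1 (star φ1)) = 0)
    (ρ0 ρ1 : Matrix (Fin a × Fin b) (Fin a × Fin b) ℂ)
    (hρ0 : ρ0.PosSemidef) (htr0 : ρ0.trace = 1)
    (hρ1 : ρ1.PosSemidef) (htr1 : ρ1.trace = 1)
    (hsame : ptraceB ρ0 = ptraceB ρ1) :
    (1 / 2) * ((1 / 2 + (1 / 2) * (star φ0 ⬝ᵥ (ρ0 *ᵥ φ0)).re)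
        + (1 / 2 + (1 / 2) * (star φ1 ⬝ᵥ (ρ1 *ᵥ φ1)).re))
      ≤ 3 / 4 := by
  rw [ptraceB_vecMulVec_star, ptraceB_vecMulVec_star,
    self_mul_conjTranspose_mul_eq_zero,
    mul_self_mul_conjTranspose_eq_zero] at horth
  obtain ⟨P, hP, hP0, hP1⟩ := exists_isStarProjection_mul_eq _ _ horth
  have h0 := dotProduct_mulVec_le_trace_ptraceB_mul hρ0 hP hunit0 hP0
  have h1 := dotProduct_mulVec_le_trace_ptraceB_mul hρ1 hP.one_sub hunit1
    (by rw [Matrix.sub_mul, Matrix.one_mul, hP1, sub_zero])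
  have h := (Complex.le_def.mp (add_le_add h0 h1)).1
  rw [← hsame, ← trace_add, ← Matrix.mul_add, add_sub_cancel, Matrix.mul_one, trace_ptraceB,
    htr0, Complex.add_re, Complex.one_re] at h
  linarith
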